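/- If σ ∈ S_n has cycle type 1^{m_1} 2^{m_2} ⋯ s^{m_s}, then the number of permutations τ ∈ S_n with τ² = σ equals the product over i from 1 to s of f(i, m_i), where f(i,m) = 0 if i is even and m is odd; f(i,m) = (m!/(m/2)!)·(i/2)^{m/2} if i and m are both even; and f(i,m) = Σ_{k=0}^{⌊m/2⌋} m!/((m−2k)!·k!)·(i/2)^k if i is odd. -/

import Mathlib

/-- The factor `f(i,m)` counting the ways of taking square roots on the `m` cycles
of length `i`. -/
noncomputable def sqrtFactor (i m : ℕ) : ℚ :=
  if Even i then
    (if Even m then ((m.factorial : ℚ) / ((m / 2).factorial : ℚ)) * ((i : ℚ) / 2) ^ (m / 2)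
     else 0)
  else
    ∑ k ∈ Finset.range (m / 2 + 1),
      ((m.factorial : ℚ) / (((m - 2 * k).factorial : ℚ) * (k.factorial : ℚ))) *
        ((i : ℚ) / 2) ^ k

/-- The number of cycles of length `i` of `σ` (with `i = 1` counting fixed points). -/
def cycleCount {n : ℕ} (σ : Equiv.Perm (Fin n)) (i : ℕ) : ℕ :=
  if i = 1 then (Finset.univ.filter fun x => σ x = x).card else σ.cycleType.count i

section

open Equiv Finset Function

lemma sqrtFactor_eq_sum_of_not_even {i : ℕ} (hi : ¬ Even i) {m K : ℕ} (hK : m / 2 < K) :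
    sqrtFactor i m =
      ∑ k ∈ range K, ((m.descFactorial (2 * k) : ℚ) / k.factorial) * ((i : ℚ) / 2) ^ k := by
  rw [sqrtFactor, if_neg hi]
  refine (sum_congr rfl fun k hk ↦ ?_).trans
    (sum_subset (range_subset_range.2 (Nat.succ_le_of_lt hK)) fun k _ hk ↦ ?_)
  · have hk' : 2 * k ≤ m := by rw [mem_range] at hk; omega
    rw [← Nat.factorial_mul_descFactorial hk']
    have := Nat.factorial_ne_zero (m - 2 * k)
    have := Nat.factorial_ne_zero k
    push_cast
    field_simp
  · have hk' : m < 2 * k := by rw [mem_range] at hk; omega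
    simp [Nat.descFactorial_of_lt hk']

@[simp]
lemma sqrtFactor_zero (i : ℕ) : sqrtFactor i 0 = 1 := by
  simp [sqrtFactor]

lemma succ_descFactorial_add_two (m k : ℕ) :
    (m + 2).descFactorial (k + 2) =
      (m + 1).descFactorial (k + 2) + (k + 2) * ((m + 1) * m.descFactorial k) := by
  rw [Nat.succ_descFactorial_succ, Nat.succ_descFactorial_succ, Nat.descFactorial_succ (m + 1),
    Nat.succ_descFactorial_succ]
  rcases le_or_gt k m with h | h
  · obtain ⟨d, rfl⟩ := Nat.exists_eq_add_of_le h
    rw [show k + d + 1 - (k + 1) = d by omega]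
    ring
  · simp [Nat.descFactorial_of_lt h]

lemma sqrtFactor_succ (i m : ℕ) :
    sqrtFactor i (m + 1) =
      (if Even i then 0 else sqrtFactor i m) + (m * i : ℕ) * sqrtFactor i (m - 1) := by
  by_cases hi : Even i
  · rw [if_pos hi, zero_add]
    rcases Nat.even_or_odd' m with ⟨k, rfl | rfl⟩
    · rcases k with _ | k
      · simp [sqrtFactor, hi]
      · have h1 : ¬ Even (2 * (k + 1) + 1) := by simp [parity_simps]
        have h2 : ¬ Even (2 * (k + 1) - 1) := by
          rw [show 2 * (k + 1) - 1 = 2 * k + 1 by omega]; simp [parity_simps]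
        simp [sqrtFactor, hi, h1, h2]
    · have h1 : Even (2 * k + 1 + 1) := by simp [parity_simps]
      simp only [sqrtFactor, hi, h1, if_true, Nat.add_sub_cancel, even_two_mul]
      rw [show (2 * k + 1 + 1) / 2 = k + 1 by omega, show 2 * k / 2 = k by omega,
        Nat.factorial_succ (2 * k + 1), Nat.factorial_succ (2 * k), Nat.factorial_succ k]
      have := Nat.factorial_ne_zero k
      push_cast
      field_simp
      ring
  · rw [if_neg hi]
    rcases m with _ | m
    · simp [sqrtFactor, hi]
    rw [sqrtFactor_eq_sum_of_not_even hi (K := m + 2) (by omega),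
      sqrtFactor_eq_sum_of_not_even hi (K := m + 2) (by omega), Nat.add_sub_cancel,
      sqrtFactor_eq_sum_of_not_even hi (K := m + 1) (by omega), sum_range_succ' _ (m + 1),
      sum_range_succ' _ (m + 1), mul_sum, add_right_comm (Finset.sum _ _), ← sum_add_distrib]
    congr 1
    refine sum_congr rfl fun k _ ↦ ?_
    rw [mul_add_one, succ_descFactorial_add_two, Nat.factorial_succ]
    have := Nat.factorial_ne_zero k
    push_cast
    field_simp
    ring

variable {α : Type*} [Fintype α] [DecidableEq α] {σ τ : Perm α} {S T : Finset α} {x y z : α}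

/-- The permutations that fix every point outside `S` and square to `σ` on `S`. -/
def sqrtsOn (σ : Perm α) (S : Finset α) : Finset (Perm α) :=
  {τ | (∀ z ∈ S, τ (τ z) = σ z) ∧ ∀ z ∉ S, τ z = z}

lemma mem_sqrtsOn : τ ∈ sqrtsOn σ S ↔ (∀ z ∈ S, τ (τ z) = σ z) ∧ ∀ z ∉ S, τ z = z := by
  simp [sqrtsOn]

lemma apply_mem_iff_of_mem_sqrtsOn (hτ : τ ∈ sqrtsOn σ S) : τ z ∈ S ↔ z ∈ S := by
  rw [mem_sqrtsOn] at hτ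
  by_cases hz : z ∈ S
  · refine iff_of_true ?_ hz
    by_contra h
    exact h (by rwa [τ.injective (hτ.2 _ h)])
  · rw [hτ.2 z hz]

omit [Fintype α] [DecidableEq α] in
lemma zpow_apply_mem_iff (hS : ∀ z, σ z ∈ S ↔ z ∈ S) (k : ℤ) (z : α) :
    (σ ^ k) z ∈ S ↔ z ∈ S := by
  induction k using Int.induction_on with
  | zero => simp
  | succ k ih => rw [add_comm, zpow_add, zpow_one, Perm.mul_apply, hS, ih]
  | pred k ih => rw [← hS, ← Perm.mul_apply, ← zpow_one_add, add_sub_cancel, ih]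

lemma apply_zpow_of_mem_sqrtsOn (hS : ∀ z, σ z ∈ S ↔ z ∈ S) (hτ : τ ∈ sqrtsOn σ S)
    (hz : z ∈ S) (k : ℤ) : τ ((σ ^ k) z) = (σ ^ k) (τ z) := by
  have comm : ∀ w ∈ S, τ (σ w) = σ (τ w) := fun w hw ↦ by
    rw [← (mem_sqrtsOn.1 hτ).1 w hw,
      (mem_sqrtsOn.1 hτ).1 _ ((apply_mem_iff_of_mem_sqrtsOn hτ).2 hw)]
  induction k using Int.induction_on with
  | zero => simp
  | succ k ih =>
    rw [add_comm, zpow_add, zpow_one, Perm.mul_apply, comm _ ((zpow_apply_mem_iff hS _ _).2 hz), ih,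
      Perm.mul_apply]
  | pred k ih =>
    apply σ.injective
    rw [← comm _ ((zpow_apply_mem_iff hS _ _).2 hz), ← Perm.mul_apply σ, ← Perm.mul_apply σ,
      ← zpow_one_add, add_sub_cancel, ih]

lemma card_filter_sqrtsOn_eqOn {τ₀ : Perm α} (hTS : T ⊆ S) (hτ₀ : τ₀ ∈ sqrtsOn σ T) :
    #{τ ∈ sqrtsOn σ S | ∀ z ∈ T, τ z = τ₀ z} = #(sqrtsOn σ (S \ T)) := by
  have hT : ∀ z, τ₀ z ∈ T ↔ z ∈ T := fun z ↦ apply_mem_iff_of_mem_sqrtsOn hτ₀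
  have h₀ := mem_sqrtsOn.1 hτ₀
  refine card_nbij' (fun τ ↦ τ₀⁻¹ * τ) (fun ρ ↦ τ₀ * ρ) ?_ ?_ ?_ ?_
  · intro τ hτ
    simp only [coe_filter, Set.mem_ofPred_eq] at hτ
    obtain ⟨hτ, hag⟩ := hτ
    have hτ' := mem_sqrtsOn.1 hτ
    have hout : ∀ z ∉ T, τ z ∉ T := fun z hz hmem ↦ by
      have h1 : τ₀⁻¹ (τ z) ∈ T := by rw [← hT]; simpa using hmem
      have h2 : τ (τ₀⁻¹ (τ z)) = τ z := by rw [hag _ h1]; simp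
      exact hz (by rwa [τ.injective h2] at h1)
    have hact : ∀ z ∉ T, (τ₀⁻¹ * τ) z = τ z := fun z hz ↦ by
      rw [Perm.mul_apply, Perm.inv_eq_iff_eq, h₀.2 _ (hout z hz)]
    rw [mem_coe, mem_sqrtsOn]
    refine ⟨fun z hz ↦ ?_, fun z hz ↦ ?_⟩
    · rw [mem_sdiff] at hz
      rw [hact z hz.2, hact _ (hout z hz.2), hτ'.1 z hz.1]
    · by_cases hzT : z ∈ T
      · rw [Perm.mul_apply, Perm.inv_eq_iff_eq, hag z hzT]
      · rw [hact z hzT]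
        exact hτ'.2 z fun h ↦ hz (mem_sdiff.2 ⟨h, hzT⟩)
  · intro ρ hρ
    have hρ' := mem_sqrtsOn.1 hρ
    have hin : ∀ z ∈ T, (τ₀ * ρ) z = τ₀ z := fun z hz ↦ by
      rw [Perm.mul_apply, hρ'.2 z fun h ↦ (mem_sdiff.1 h).2 hz]
    have hout : ∀ z ∈ S \ T, (τ₀ * ρ) z = ρ z := fun z hz ↦ by
      rw [Perm.mul_apply, h₀.2]
      exact (mem_sdiff.1 ((apply_mem_iff_of_mem_sqrtsOn hρ).2 hz)).2
    rw [mem_coe, mem_filter, mem_sqrtsOn]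
    refine ⟨⟨fun z hz ↦ ?_, fun z hz ↦ ?_⟩, hin⟩
    · by_cases hzT : z ∈ T
      · rw [hin z hzT, hin _ ((hT z).2 hzT), h₀.1 z hzT]
      · have hz' := mem_sdiff.2 ⟨hz, hzT⟩
        rw [hout z hz', hout _ ((apply_mem_iff_of_mem_sqrtsOn hρ).2 hz'), hρ'.1 z hz']
    · have hzT : z ∉ T := fun h ↦ hz (hTS h)
      rw [Perm.mul_apply, hρ'.2 z fun h ↦ hz (mem_sdiff.1 h).1, h₀.2 z hzT]
  · intro τ _
    simp
  · intro ρ _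
    simp

omit [Fintype α] [DecidableEq α] in
lemma zpow_apply_eq_self_iff (k : ℤ) :
    (σ ^ k) x = x ↔ (minimalPeriod σ x : ℤ) ∣ k :=
  MulAction.zpow_smul_eq_iff_minimalPeriod_dvd (a := σ) (b := x) (n := k)

omit [Fintype α] [DecidableEq α] in
lemma zpow_apply_eq_zpow_apply_iff (k l : ℤ) :
    (σ ^ k) x = (σ ^ l) x ↔ (minimalPeriod σ x : ℤ) ∣ k - l := by
  rw [← zpow_apply_eq_self_iff, sub_eq_neg_add, zpow_add, Perm.mul_apply, zpow_neg,
    Perm.inv_eq_iff_eq, eq_comm, eq_comm]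

omit [DecidableEq α] in
lemma minimalPeriod_pos' (σ : Perm α) (x : α) : 0 < minimalPeriod σ x :=
  minimalPeriod_pos_of_mem_periodicPts (σ.injective.mem_periodicPts x)

omit [Fintype α] [DecidableEq α] in
lemma minimalPeriod_eq_of_zpow_iff (h : ∀ k : ℤ, (σ ^ k) x = x ↔ (σ ^ k) y = y) :
    minimalPeriod σ x = minimalPeriod σ y := by
  simp only [zpow_apply_eq_self_iff] at h
  exact Nat.dvd_antisymm (Int.natCast_dvd_natCast.1 ((h _).2 dvd_rfl))
    (Int.natCast_dvd_natCast.1 ((h _).1 dvd_rfl))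

omit [Fintype α] [DecidableEq α] in
lemma minimalPeriod_eq_of_sameCycle (h : σ.SameCycle x y) :
    minimalPeriod σ x = minimalPeriod σ y := by
  obtain ⟨l, rfl⟩ := h
  refine minimalPeriod_eq_of_zpow_iff fun k ↦ ?_
  rw [← Perm.mul_apply, ← zpow_add, add_comm, zpow_add, Perm.mul_apply,
    (σ ^ l).injective.eq_iff]

lemma minimalPeriod_apply_of_mem_sqrtsOn (hS : ∀ z, σ z ∈ S ↔ z ∈ S) (hτ : τ ∈ sqrtsOn σ S)
    (hz : z ∈ S) : minimalPeriod σ (τ z) = minimalPeriod σ z :=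
  minimalPeriod_eq_of_zpow_iff fun k ↦ by
    rw [← apply_zpow_of_mem_sqrtsOn hS hτ hz, τ.injective.eq_iff]

/-- The cycle of `σ` through `x`, as a set of points. -/
def cycleSet (σ : Perm α) (x : α) : Finset α := {y | σ.SameCycle x y}

lemma mem_cycleSet : y ∈ cycleSet σ x ↔ σ.SameCycle x y := by simp [cycleSet]

lemma apply_mem_cycleSet_iff : σ z ∈ cycleSet σ x ↔ z ∈ cycleSet σ x := by
  simp [mem_cycleSet]

lemma card_cycleSet (σ : Perm α) (x : α) : #(cycleSet σ x) = minimalPeriod σ x := by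
  have hp : (0 : ℤ) < minimalPeriod σ x := by exact_mod_cast minimalPeriod_pos' σ x
  have : cycleSet σ x = (range (minimalPeriod σ x)).image fun k : ℕ ↦ (σ ^ (k : ℤ)) x := by
    ext y
    rw [mem_cycleSet, mem_image]
    constructor
    · rintro ⟨k, rfl⟩
      refine ⟨(k % minimalPeriod σ x).toNat, ?_, ?_⟩
      · rw [mem_range]
        have := Int.emod_lt_of_pos k hp
        have := Int.emod_nonneg k hp.ne'
        omega
      · rw [Int.toNat_of_nonneg (Int.emod_nonneg k hp.ne'), zpow_apply_eq_zpow_apply_iff]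
        exact (Int.mod_modEq k _).symm.dvd
    · rintro ⟨k, _, rfl⟩
      exact ⟨k, rfl⟩
  rw [this, card_image_of_injOn, card_range]
  intro k hk l hl h
  rw [coe_range, Set.mem_Iio] at hk hl
  rw [zpow_apply_eq_zpow_apply_iff, ← Int.modEq_iff_dvd, Int.natCast_modEq_iff] at h
  exact (Nat.ModEq.eq_of_lt_of_lt h hl hk).symm

lemma cycleOf_zpow_mem_sqrtsOn {j : ℤ} (h : (minimalPeriod σ x : ℤ) ∣ 2 * j - 1) :
    (σ.cycleOf x) ^ j ∈ sqrtsOn σ (cycleSet σ x) := by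
  rw [mem_sqrtsOn]
  refine ⟨fun z hz ↦ ?_, fun z hz ↦ ?_⟩
  · rw [mem_cycleSet] at hz
    rw [hz.cycleOf_eq, Perm.cycleOf_zpow_apply_self, ← Perm.cycleOf_self_apply_zpow σ j z,
      Perm.cycleOf_zpow_apply_self, ← Perm.mul_apply, ← zpow_add, ← two_mul]
    nth_rewrite 2 [← zpow_one σ]
    rwa [zpow_apply_eq_zpow_apply_iff, ← minimalPeriod_eq_of_sameCycle hz]
  · rw [mem_cycleSet] at hz
    exact Perm.zpow_apply_eq_self_of_apply_eq_self (Perm.cycleOf_apply_of_not_sameCycle hz) j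

lemma exists_mem_sqrtsOn_union (hp : minimalPeriod σ x = minimalPeriod σ y)
    (hxy : ¬ σ.SameCycle x y) :
    ∃ τ ∈ sqrtsOn σ (cycleSet σ x ∪ cycleSet σ y), τ x = y := by
  classical
  let f : α → α := fun z ↦
    if h : σ.SameCycle x z then (σ ^ h.choose) y
    else if h : σ.SameCycle y z then (σ ^ (h.choose + 1)) x else z
  have hfx (k : ℤ) : f ((σ ^ k) x) = (σ ^ k) y := by
    have h : σ.SameCycle x ((σ ^ k) x) := ⟨k, rfl⟩
    simp only [f, dif_pos h]
    rw [zpow_apply_eq_zpow_apply_iff, ← hp, ← zpow_apply_eq_zpow_apply_iff]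
    exact h.choose_spec
  have hfy (k : ℤ) : f ((σ ^ k) y) = (σ ^ (k + 1)) x := by
    have h : σ.SameCycle y ((σ ^ k) y) := ⟨k, rfl⟩
    have h' : ¬ σ.SameCycle x ((σ ^ k) y) := fun h' ↦ hxy (h'.trans h.symm)
    simp only [f, dif_neg h', dif_pos h]
    rw [zpow_apply_eq_zpow_apply_iff, add_sub_add_right_eq_sub, hp, ← zpow_apply_eq_zpow_apply_iff]
    exact h.choose_spec
  have hf (z : α) (hx : ¬ σ.SameCycle x z) (hy : ¬ σ.SameCycle y z) : f z = z := by
    simp only [f, dif_neg hx, dif_neg hy]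
  have hsurj : Surjective f := by
    intro z
    by_cases hx : σ.SameCycle x z
    · obtain ⟨k, rfl⟩ := hx
      exact ⟨(σ ^ (k - 1)) y, by rw [hfy, sub_add_cancel]⟩
    by_cases hy : σ.SameCycle y z
    · obtain ⟨k, rfl⟩ := hy
      exact ⟨_, hfx k⟩
    exact ⟨z, hf z hx hy⟩
  refine ⟨Equiv.ofBijective f (Finite.surjective_iff_bijective.1 hsurj), ?_, by simpa using hfx 0⟩
  simp only [mem_sqrtsOn, mem_union, mem_cycleSet, Equiv.ofBijective_apply, not_or]
  refine ⟨?_, fun z hz ↦ hf z hz.1 hz.2⟩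
  rintro z (⟨k, rfl⟩ | ⟨k, rfl⟩)
  · rw [hfx, hfy, add_comm, zpow_one_add, Perm.mul_apply]
  · rw [hfy, hfx, add_comm, zpow_one_add, Perm.mul_apply]

lemma cycleSet_subset (hS : ∀ z, σ z ∈ S ↔ z ∈ S) (hx : x ∈ S) : cycleSet σ x ⊆ S := by
  intro z hz
  obtain ⟨k, rfl⟩ := mem_cycleSet.1 hz
  exact (zpow_apply_mem_iff hS k x).2 hx

lemma eqOn_cycleSet {τ₀ : Perm α} (hS : ∀ z, σ z ∈ S ↔ z ∈ S) (hT : ∀ z, σ z ∈ T ↔ z ∈ T)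
    (hτ : τ ∈ sqrtsOn σ S) (hτ₀ : τ₀ ∈ sqrtsOn σ T) (hxS : x ∈ S) (hxT : x ∈ T)
    (h : τ x = τ₀ x) (hz : z ∈ cycleSet σ x) : τ z = τ₀ z := by
  obtain ⟨k, rfl⟩ := mem_cycleSet.1 hz
  rw [apply_zpow_of_mem_sqrtsOn hS hτ hxS, apply_zpow_of_mem_sqrtsOn hT hτ₀ hxT, h]

lemma dvd_of_mem_sqrtsOn (hS : ∀ z, σ z ∈ S ↔ z ∈ S) (hτ : τ ∈ sqrtsOn σ S) (hx : x ∈ S)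
    {k : ℤ} (hk : (σ ^ k) x = τ x) : (minimalPeriod σ x : ℤ) ∣ 2 * k - 1 := by
  rw [← zpow_apply_eq_zpow_apply_iff, zpow_one, ← (mem_sqrtsOn.1 hτ).1 x hx, ← hk,
    apply_zpow_of_mem_sqrtsOn hS hτ hx, ← hk, ← Perm.mul_apply, ← zpow_add, two_mul]

lemma card_filter_sqrtsOn_sameCycle (hS : ∀ z, σ z ∈ S ↔ z ∈ S) (hx : x ∈ S) :
    #{τ ∈ sqrtsOn σ S | σ.SameCycle x (τ x)} =
      if Even (minimalPeriod σ x) then 0 else #(sqrtsOn σ (S \ cycleSet σ x)) := by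
  split_ifs with hp
  · rw [card_eq_zero, filter_eq_empty_iff]
    rintro τ hτ ⟨k, hk⟩
    have := (Int.natCast_dvd_natCast.2 hp.two_dvd).trans (dvd_of_mem_sqrtsOn hS hτ hx hk)
    push_cast at this
    omega
  · obtain ⟨j, hj⟩ := Nat.not_even_iff_odd.1 hp
    have hdvd : (minimalPeriod σ x : ℤ) ∣ 2 * (j + 1 : ℤ) - 1 :=
      ⟨1, by rw [hj]; push_cast; ring⟩
    have hτ₀ := cycleOf_zpow_mem_sqrtsOn hdvd
    rw [← card_filter_sqrtsOn_eqOn (cycleSet_subset hS hx) hτ₀]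
    congr 1
    refine filter_congr fun τ hτ ↦ ⟨?_, fun h ↦ ?_⟩
    · rintro ⟨k, hk⟩ z hz
      have hxC : x ∈ cycleSet σ x := mem_cycleSet.2 (Perm.SameCycle.refl _ _)
      refine eqOn_cycleSet hS (fun _ ↦ apply_mem_cycleSet_iff) hτ hτ₀ hx hxC ?_ hz
      rw [Perm.cycleOf_zpow_apply_self, ← hk, zpow_apply_eq_zpow_apply_iff]
      have h2 := dvd_sub (dvd_of_mem_sqrtsOn hS hτ hx hk) hdvd
      rw [sub_sub_sub_cancel_right, ← mul_sub] at h2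
      refine IsCoprime.dvd_of_dvd_mul_left ?_ h2
      exact ⟨1, -j, by rw [hj]; push_cast; ring⟩
    · rw [h x (mem_cycleSet.2 (Perm.SameCycle.refl _ _)), Perm.cycleOf_zpow_apply_self]
      exact ⟨_, rfl⟩

lemma card_filter_sqrtsOn_apply_eq (hS : ∀ z, σ z ∈ S ↔ z ∈ S) (hx : x ∈ S) (hy : y ∈ S)
    (hp : minimalPeriod σ y = minimalPeriod σ x) (hxy : ¬ σ.SameCycle x y) :
    #{τ ∈ sqrtsOn σ S | τ x = y} = #(sqrtsOn σ (S \ (cycleSet σ x ∪ cycleSet σ y))) := by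
  obtain ⟨τ₀, hτ₀, hτ₀x⟩ := exists_mem_sqrtsOn_union hp.symm hxy
  have hxT : x ∈ cycleSet σ x ∪ cycleSet σ y :=
    mem_union_left _ (mem_cycleSet.2 (Perm.SameCycle.refl _ _))
  have hyT : y ∈ cycleSet σ x ∪ cycleSet σ y :=
    mem_union_right _ (mem_cycleSet.2 (Perm.SameCycle.refl _ _))
  rw [← card_filter_sqrtsOn_eqOn (union_subset (cycleSet_subset hS hx) (cycleSet_subset hS hy)) hτ₀]
  congr 1
  refine filter_congr fun τ hτ ↦ ⟨fun h z hz ↦ ?_, fun h ↦ by rw [h x hxT, hτ₀x]⟩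
  have hT : ∀ z, σ z ∈ cycleSet σ x ∪ cycleSet σ y ↔ z ∈ cycleSet σ x ∪ cycleSet σ y := fun z ↦ by
    simp only [mem_union, apply_mem_cycleSet_iff]
  rcases mem_union.1 hz with hz | hz
  · exact eqOn_cycleSet hS hT hτ hτ₀ hx hxT (h.trans hτ₀x.symm) hz
  · refine eqOn_cycleSet hS hT hτ hτ₀ hy hyT ?_ hz
    nth_rewrite 1 [← h]
    rw [← hτ₀x, (mem_sqrtsOn.1 hτ).1 x hx, (mem_sqrtsOn.1 hτ₀).1 x hxT]

lemma card_sqrtsOn_eq_add_sum (hS : ∀ z, σ z ∈ S ↔ z ∈ S) (hx : x ∈ S) :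
    #(sqrtsOn σ S) =
      (if Even (minimalPeriod σ x) then 0 else #(sqrtsOn σ (S \ cycleSet σ x))) +
      ∑ y ∈ {y ∈ S | minimalPeriod σ y = minimalPeriod σ x} \ cycleSet σ x,
        #(sqrtsOn σ (S \ (cycleSet σ x ∪ cycleSet σ y))) := by
  rw [← card_filter_sqrtsOn_sameCycle hS hx,
    ← card_filter_add_card_filter_not (s := sqrtsOn σ S) fun τ ↦ σ.SameCycle x (τ x)]
  congr 1
  rw [card_eq_sum_card_fiberwise (f := fun τ : Perm α ↦ τ x)
    (t := {y ∈ S | minimalPeriod σ y = minimalPeriod σ x} \ cycleSet σ x)]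
  · refine sum_congr rfl fun y hy ↦ ?_
    rw [mem_sdiff, mem_filter, mem_cycleSet] at hy
    rw [← card_filter_sqrtsOn_apply_eq hS hx hy.1.1 hy.1.2 hy.2, filter_filter]
    congr 1
    refine filter_congr fun τ _ ↦ and_iff_right_of_imp ?_
    rintro rfl
    exact hy.2
  · intro τ hτ
    simp only [coe_filter, Set.mem_ofPred_eq] at hτ
    simp only [coe_sdiff, coe_filter, Set.mem_sdiff, Set.mem_ofPred_eq, mem_coe, mem_cycleSet]
    exact ⟨⟨(apply_mem_iff_of_mem_sqrtsOn hτ.1).2 hx,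
      minimalPeriod_apply_of_mem_sqrtsOn hS hτ.1 hx⟩, hτ.2⟩

omit [Fintype α] in
lemma mul_update_eq_card_sdiff {m : ℕ → ℕ} (hm : ∀ i, i * m i = #{z ∈ S | minimalPeriod σ z = i})
    {i a : ℕ} (hTS : T ⊆ S) (hT : ∀ z ∈ T, minimalPeriod σ z = i) (ha : i * m i = i * a + #T)
    (j : ℕ) : j * update m i a j = #{z ∈ S \ T | minimalPeriod σ z = j} := by
  rcases eq_or_ne j i with rfl | hj
  · have h : {z ∈ S \ T | minimalPeriod σ z = j} = {z ∈ S | minimalPeriod σ z = j} \ T := by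
      ext z; simp only [mem_filter, mem_sdiff]; tauto
    rw [h, card_sdiff_of_subset fun z hz ↦ mem_filter.2 ⟨hTS hz, hT z hz⟩, ← hm, update_self, ha,
      Nat.add_sub_cancel]
  · rw [update_of_ne hj, hm]
    congr 1
    ext z
    simp only [mem_filter, mem_sdiff]
    refine and_congr_left fun hz ↦ (and_iff_left fun hzT ↦ hj ?_).symm
    rw [← hz, hT z hzT]

lemma card_sqrtsOn (σ : Perm α) {I : Finset ℕ} (hI₀ : 0 ∉ I) (hI : ∀ z, minimalPeriod σ z ∈ I)
    (S : Finset α) (hS : ∀ z, σ z ∈ S ↔ z ∈ S) (m : ℕ → ℕ)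
    (hm : ∀ i, i * m i = #{z ∈ S | minimalPeriod σ z = i}) :
    (#(sqrtsOn σ S) : ℚ) = ∏ i ∈ I, sqrtFactor i (m i) := by
  induction S using Finset.strongInduction generalizing m with
  | H S ih =>
  rcases S.eq_empty_or_nonempty with rfl | ⟨x, hx⟩
  · have h1 : sqrtsOn σ ∅ = {1} := by
      ext τ; simp [mem_sqrtsOn, Equiv.ext_iff]
    rw [h1, card_singleton, Nat.cast_one, eq_comm]
    refine prod_eq_one fun i hi ↦ ?_
    have h2 : m i = 0 := by
      have := hm i
      rw [filter_empty, card_empty, mul_eq_zero] at this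
      exact this.resolve_left fun h ↦ hI₀ (h ▸ hi)
    rw [h2, sqrtFactor_zero]
  set p := minimalPeriod σ x with hp
  have hxC : x ∈ cycleSet σ x := mem_cycleSet.2 (Perm.SameCycle.refl _ _)
  have hCS := cycleSet_subset hS hx
  have hCp (y : α) : ∀ z ∈ cycleSet σ y, minimalPeriod σ z = minimalPeriod σ y := fun z hz ↦
    (minimalPeriod_eq_of_sameCycle (mem_cycleSet.1 hz)).symm
  have hCF : cycleSet σ x ⊆ {z ∈ S | minimalPeriod σ z = p} := fun z hz ↦
    mem_filter.2 ⟨hCS hz, hCp x z hz⟩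
  obtain ⟨k, hk⟩ : ∃ k, m p = k + 1 := by
    refine Nat.exists_eq_succ_of_ne_zero fun h ↦ ?_
    have := hm p
    rw [h, mul_zero, eq_comm, card_eq_zero] at this
    exact absurd (hCF hxC) (by simp [this])
  have hF : #({z ∈ S | minimalPeriod σ z = p} \ cycleSet σ x) = p * k := by
    rw [card_sdiff_of_subset hCF, card_cycleSet, ← hm, hk, mul_add_one, Nat.add_sub_cancel]
  have hprod (a : ℕ) : ∏ i ∈ I, sqrtFactor i (update m p a i) =
      sqrtFactor p a * ∏ i ∈ I.erase p, sqrtFactor i (m i) := by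
    rw [← mul_prod_erase I _ (hI x), update_self]
    congr 1
    exact prod_congr rfl fun i hi ↦ by rw [update_of_ne (ne_of_mem_erase hi)]
  have h₁ : (#(sqrtsOn σ (S \ cycleSet σ x)) : ℚ) =
      sqrtFactor p k * ∏ i ∈ I.erase p, sqrtFactor i (m i) := by
    rw [← hprod]
    refine ih _ (sdiff_ssubset hCS ⟨x, hxC⟩) (fun z ↦ ?_) _
      (mul_update_eq_card_sdiff hm hCS (hCp x) ?_)
    · rw [mem_sdiff, mem_sdiff, hS, apply_mem_cycleSet_iff]
    · rw [hk, card_cycleSet, mul_add_one]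
  have h₂ : ∀ y ∈ {y ∈ S | minimalPeriod σ y = p} \ cycleSet σ x,
      (#(sqrtsOn σ (S \ (cycleSet σ x ∪ cycleSet σ y))) : ℚ) =
        sqrtFactor p (k - 1) * ∏ i ∈ I.erase p, sqrtFactor i (m i) := by
    intro y hy
    have hk₀ : k ≠ 0 := by
      rintro rfl
      rw [mul_zero, card_eq_zero] at hF
      simp [hF] at hy
    rw [mem_sdiff, mem_filter, mem_cycleSet] at hy
    have hTS := union_subset hCS (cycleSet_subset hS hy.1.1)
    rw [← hprod]
    refine ih _ (sdiff_ssubset hTS ⟨x, mem_union_left _ hxC⟩) (fun z ↦ ?_) _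
      (mul_update_eq_card_sdiff hm hTS (fun z hz ↦ ?_) ?_)
    · simp only [mem_sdiff, mem_union, hS, apply_mem_cycleSet_iff]
    · rcases mem_union.1 hz with hz | hz
      · exact hCp x z hz
      · rw [hCp y z hz, hy.1.2]
    · rw [card_union_of_disjoint, card_cycleSet, card_cycleSet, hy.1.2, ← hp, hk]
      · obtain ⟨l, rfl⟩ := Nat.exists_eq_add_one_of_ne_zero hk₀
        rw [Nat.add_sub_cancel]
        ring
      · refine disjoint_left.2 fun z hzx hzy ↦ hy.2 ?_
        exact (mem_cycleSet.1 hzx).trans (mem_cycleSet.1 hzy).symm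
  rw [card_sqrtsOn_eq_add_sum hS hx, Nat.cast_add, Nat.cast_sum, sum_congr rfl h₂, sum_const, hF,
    ← mul_prod_erase I _ (hI x), ← hp, hk, sqrtFactor_succ, nsmul_eq_mul, mul_comm p k]
  split_ifs
  · push_cast; ring
  · rw [h₁]; ring

lemma mul_cycleCount {n : ℕ} (σ : Perm (Fin n)) (i : ℕ) :
    i * cycleCount σ i = #{z | minimalPeriod σ z = i} := by
  rw [cycleCount]
  split_ifs with hi
  · subst hi
    rw [one_mul]
    congr 1
    exact filter_congr fun z _ ↦ minimalPeriod_eq_one_iff_isFixedPt.symm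
  · have hsupp (z : Fin n) (hz : z ∈ σ.support) : (σ.cycleOf z).support = cycleSet σ z := by
      ext w
      rw [Perm.mem_support_cycleOf_iff, mem_cycleSet, and_iff_left hz]
    rw [Perm.cycleType_def, Multiset.count_map, ← filter_val, ← card_def, mul_comm, eq_comm,
      card_eq_sum_card_fiberwise (f := σ.cycleOf)
        (t := {c ∈ σ.cycleFactorsFinset | i = (card ∘ Perm.support) c}), sum_const_nat]
    · intro c hc
      rw [mem_filter, comp_apply] at hc
      rw [hc.2]
      congr 1
      ext z
      simp only [mem_filter, mem_univ, true_and]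
      constructor
      · rintro ⟨_, rfl⟩
        rw [Perm.mem_support_cycleOf_iff]
        exact ⟨Perm.SameCycle.refl _ _, Perm.cycleOf_mem_cycleFactorsFinset_iff.1 hc.1⟩
      · intro hz
        have h := (Perm.cycle_is_cycleOf hz hc.1)
        refine ⟨?_, h.symm⟩
        rw [h, hsupp, card_cycleSet]
        exact Perm.mem_cycleFactorsFinset_support_le hc.1 hz
    · intro z hz
      simp only [coe_filter, mem_univ, true_and, Set.mem_ofPred_eq, comp_apply] at hz ⊢
      have hz' : z ∈ σ.support := by
        rw [Perm.mem_support]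
        exact fun h ↦ hi (by rw [← hz]; exact minimalPeriod_eq_one_iff_isFixedPt.2 h)
      rw [hsupp z hz', card_cycleSet, Perm.cycleOf_mem_cycleFactorsFinset_iff]
      exact ⟨hz', hz.symm⟩

end

theorem card_square_roots {n : ℕ} (σ : Equiv.Perm (Fin n)) :
    (Nat.card {τ : Equiv.Perm (Fin n) // τ ^ 2 = σ} : ℚ) =
      ∏ i ∈ Finset.Icc 1 n, sqrtFactor i (cycleCount σ i) := by
  rw [← card_sqrtsOn σ (by simp) (fun z ↦ ?_) Finset.univ (by simp) _ (mul_cycleCount σ)]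
  · rw [Nat.card_eq_fintype_card, Fintype.card_subtype]
    congr 2
    ext τ
    simp [mem_sqrtsOn, Equiv.ext_iff, sq]
  · rw [Finset.mem_Icc]
    refine ⟨minimalPeriod_pos' σ z, ?_⟩
    rw [← card_cycleSet]
    exact (Finset.card_le_univ _).trans_eq (Fintype.card_fin n)
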